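/- Fix an S_d-EL-labeling λ of the Boolean lattice B_d and S ⊆ [d−1], and let d_1, …, d_t be as in the associated construction. Let c be the unique maximal chain of B_d with strictly increasing λ-label. Then Υ_λ((d_1)_{[d−1]∖S}) = c. -/

import Mathlib

/-- The label word of a chain, listed as a list of elements: the list of labels of
consecutive (covering) pairs. -/
def chainWord {α : Type*} (lab : α → α → ℤ) (l : List α) : List ℤ :=
  (l.zip l.tail).map fun p => lab p.1 p.2

/-- `l` is a saturated chain from `x` to `y`: a list `x = x_0 ⋖ x_1 ⋖ ⋯ ⋖ x_t = y`. -/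
def IsSatChain {α : Type*} [PartialOrder α] (x y : α) (l : List α) : Prop :=
  l.Chain' (· ⋖ ·) ∧ l.head? = some x ∧ l.getLast? = some y

/-- `lab` is an EL-labeling: every interval `[x,y]` has a unique saturated chain with
strictly increasing label, and this label lexicographically (strictly) precedes the label
of every other saturated chain of `[x,y]`. -/
def IsELLabeling {α : Type*} [PartialOrder α] (lab : α → α → ℤ) : Prop :=
  ∀ x y : α, x ≤ y →
    (∃! l : List α, IsSatChain x y l ∧ (chainWord lab l).Chain' (· < ·)) ∧
    ∀ l l' : List α, IsSatChain x y l → (chainWord lab l).Chain' (· < ·) →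
      IsSatChain x y l' → l' ≠ l →
      List.Lex (· < ·) (chainWord lab l) (chainWord lab l')

/-- An `S_d`-EL-labeling of a bounded poset: an EL-labeling in which the label of every
maximal chain is a permutation of `[d] = {1,…,d}`. -/
def IsSdELLabeling {α : Type*} [PartialOrder α] [BoundedOrder α] (d : ℕ)
    (lab : α → α → ℤ) : Prop :=
  IsELLabeling lab ∧
    ∀ l : List α, IsSatChain (⊥ : α) (⊤ : α) l →
      (chainWord lab l).Perm ((List.range d).map fun i => (i : ℤ) + 1)

/-- The descent set of a word `w_1 ⋯ w_n` : the set of `i ∈ {1,…,n−1}` with `w_i > w_{i+1}`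
(positions are `1`-based). -/
def wordDescents {β : Type*} [LinearOrder β] [Inhabited β] (w : List β) : Finset ℕ :=
  (Finset.Icc 1 (w.length - 1)).filter fun i => w.getD i default < w.getD (i - 1) default

/-- The rank-selected subchain `c_R` of a chain `c` in `B_d`: the elements of `c` whose
rank (cardinality) lies in `R ∪ {0, d}`. -/
def rsel (d : ℕ) (R : Finset ℕ) (l : List (Finset (Fin d))) : List (Finset (Fin d)) :=
  l.filter fun x => decide (x.card ∈ R ∪ ({0, d} : Finset ℕ))

/-- The set of maximal chains of the subposet `L_i` of `(B_d)_S`: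
`{c_S : c a maximal chain of B_d with c_{[d−1]∖S} = (d_i)_{[d−1]∖S}}`, where `d_i` is the
`i`-th entry of the list `D = [d_1, …, d_t]`. -/
def Mchain (d : ℕ) (S : Finset ℕ) (D : List (List (Finset (Fin d)))) (i : ℕ) :
    Set (List (Finset (Fin d))) :=
  {m | ∃ c : List (Finset (Fin d)), IsSatChain (⊥ : Finset (Fin d)) (⊤ : Finset (Fin d)) c ∧
    rsel d (Finset.Icc 1 (d - 1) \ S) c = rsel d (Finset.Icc 1 (d - 1) \ S) (D.getD i []) ∧
    m = rsel d S c}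

/-- The facets of `Γ_i`: the maximal chains of `L_i` that are not chains of `L_j` for any
`j < i` (a chain of `L_j` is a chain all of whose elements belong to `L_j`, i.e. lie on
some maximal chain of `L_j`). -/
def GammaFacet (d : ℕ) (S : Finset ℕ) (D : List (List (Finset (Fin d)))) (i : ℕ) :
    Set (List (Finset (Fin d))) :=
  {e | e ∈ Mchain d S D i ∧
    ¬ ∃ j < i, ∀ x ∈ e, ∃ m ∈ Mchain d S D j, x ∈ m}

/-- `l = Υ_λ(e)`: `l` is the maximal chain obtained from the chain `e` (which contains
`0̂` and `1̂`) by filling in each gap of `e` with the unique saturated chain of increasing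
`λ`-label of the corresponding interval.  Equivalently (given that `λ` is an
EL-labeling): `l` is a maximal chain containing `e` whose label word has descents only at
positions crossing elements of `e`. -/
def IsUpsilon (d : ℕ) (lab : Finset (Fin d) → Finset (Fin d) → ℤ)
    (e l : List (Finset (Fin d))) : Prop :=
  IsSatChain (⊥ : Finset (Fin d)) (⊤ : Finset (Fin d)) l ∧ e.Sublist l ∧
  ∀ k : ℕ, k + 1 < (chainWord lab l).length →
    (chainWord lab l).getD (k + 1) 0 < (chainWord lab l).getD k 0 →
    l.getD (k + 1) ⊥ ∈ e

section InsertChain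

variable {α : Type*} [DecidableEq α]

/-- The chain obtained from `A` by inserting the entries of a list one after the other. -/
def insertChain : Finset α → List α → List (Finset α)
  | A, [] => [A]
  | A, a :: p => A :: insertChain (insert a A) p

lemma head?_insertChain (A : Finset α) (p : List α) : (insertChain A p).head? = some A := by
  cases p <;> rfl

lemma insertChain_ne_nil (A : Finset α) (p : List α) : insertChain A p ≠ [] := by
  cases p <;> simp [insertChain]

lemma isSatChain_insertChain (A : Finset α) (p : List α) (hp : p.Nodup)
    (hA : ∀ x ∈ p, x ∉ A) : IsSatChain A (A ∪ p.toFinset) (insertChain A p) := by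
  induction p generalizing A with
  | nil => exact ⟨List.isChain_singleton _, rfl, by simp [insertChain]⟩
  | cons a p ih =>
    simp only [List.nodup_cons, List.mem_cons, forall_eq_or_imp] at hp hA
    obtain ⟨h1, h2, h3⟩ := ih (insert a A) hp.2 (by
      intro x hx; rw [Finset.mem_insert]; rintro (rfl | h)
      · exact hp.1 hx
      · exact hA.2 x hx h)
    refine ⟨?_, rfl, ?_⟩
    · refine List.isChain_cons.2 ⟨?_, h1⟩
      intro y hy
      rw [h2] at hy
      cases hy
      exact Finset.covBy_insert hA.1
    · rw [insertChain, List.getLast?_cons_of_ne_nil (insertChain_ne_nil _ _), h3]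
      simp [Finset.union_insert, Finset.insert_union]

lemma IsSatChain.exists_eq_insertChain {A B : Finset α} {l : List (Finset α)}
    (h : IsSatChain A B l) :
    ∃ p : List α, p.Nodup ∧ (∀ x ∈ p, x ∉ A) ∧ l = insertChain A p ∧ B = A ∪ p.toFinset := by
  induction l generalizing A with
  | nil => simp [IsSatChain] at h
  | cons X l ih =>
    obtain ⟨h1, h2, h3⟩ := h
    obtain rfl : X = A := by simpa using h2
    cases l with
    | nil => exact ⟨[], by simp_all [insertChain]⟩
    | cons Y l =>
      obtain ⟨h4, h5⟩ := List.isChain_cons_cons.1 h1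
      obtain ⟨a, ha, rfl⟩ := Finset.covBy_iff_exists_insert.1 h4
      obtain ⟨p, hp, hpA, hl, hB⟩ := ih (A := insert a X) ⟨h5, rfl, by simpa using h3⟩
      refine ⟨a :: p, List.nodup_cons.2 ⟨fun h => hpA a h (by simp), hp⟩, ?_, ?_, ?_⟩
      · intro x hx
        rcases List.mem_cons.1 hx with rfl | hx
        · exact ha
        · exact fun h => hpA x hx (by simp [h])
      · rw [hl, insertChain]
      · rw [hB]; simp

lemma getElem?_insertChain (A : Finset α) (p : List α) (k : ℕ) (hk : k ≤ p.length) :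
    (insertChain A p)[k]? = some (A ∪ (p.take k).toFinset) := by
  induction p generalizing A k with
  | nil => simp_all [insertChain]
  | cons a p ih =>
    cases k with
    | zero => simp [insertChain]
    | succ k =>
      rw [insertChain, List.getElem?_cons_succ, ih _ _ (by simpa using hk)]
      simp

lemma length_insertChain (A : Finset α) (p : List α) :
    (insertChain A p).length = p.length + 1 := by
  induction p generalizing A with
  | nil => rfl
  | cons a p ih => simp [insertChain, ih]

lemma exists_take_of_mem_insertChain {A X : Finset α} {p : List α} (h : X ∈ insertChain A p) :
    ∃ k ≤ p.length, X = A ∪ (p.take k).toFinset := by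
  obtain ⟨k, hk⟩ := List.mem_iff_getElem?.1 h
  have hlt : k < (insertChain A p).length := (List.getElem?_eq_some_iff.1 hk).1
  rw [length_insertChain] at hlt
  refine ⟨k, by omega, ?_⟩
  rw [getElem?_insertChain _ _ _ (by omega)] at hk
  exact (Option.some.inj hk).symm

lemma chainWord_insertChain_cons (lab : Finset α → Finset α → ℤ) (A : Finset α) (a : α)
    (p : List α) : chainWord lab (insertChain A (a :: p)) =
      lab A (insert a A) :: chainWord lab (insertChain (insert a A) p) := by
  cases p <;> simp [insertChain, chainWord]

lemma chainWord_insertChain_append (lab : Finset α → Finset α → ℤ) (A : Finset α)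
    (p q : List α) : chainWord lab (insertChain A (p ++ q)) =
      chainWord lab (insertChain A p) ++ chainWord lab (insertChain (A ∪ p.toFinset) q) := by
  induction p generalizing A with
  | nil => simp [insertChain, chainWord]
  | cons a p ih =>
    rw [List.cons_append, chainWord_insertChain_cons, ih, chainWord_insertChain_cons]
    simp

lemma chainWord_insertChain_eq_map (lab : Finset α → Finset α → ℤ) (σ : α → ℤ)
    (hσ : ∀ A : Finset α, ∀ a ∉ A, lab A (insert a A) = σ a) (A : Finset α) (p : List α)
    (hp : p.Nodup) (hA : ∀ x ∈ p, x ∉ A) : chainWord lab (insertChain A p) = p.map σ := by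
  induction p generalizing A with
  | nil => rfl
  | cons a p ih =>
    rw [List.nodup_cons] at hp
    rw [chainWord_insertChain_cons, hσ A a (hA a (by simp)), List.map_cons, ih _ hp.2]
    intro x hx h
    rcases Finset.mem_insert.1 h with rfl | h
    · exact hp.1 hx
    · exact hA x (by simp [hx]) h

end InsertChain

lemma lex_lt_asymm {v w : List ℤ} (h : List.Lex (· < ·) v w) : ¬ List.Lex (· < ·) w v :=
  fun h' => lt_asymm (show v < w from h) h'

section Labeling

variable {d : ℕ} {lab : Finset (Fin d) → Finset (Fin d) → ℤ}

lemma isSatChain_bot_top_insertChain {p : List (Fin d)} (hp : p.Nodup) (hmem : ∀ x, x ∈ p) :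
    IsSatChain (⊥ : Finset (Fin d)) ⊤ (insertChain ∅ p) := by
  have h := isSatChain_insertChain ∅ p hp (by simp)
  have hu : (∅ ∪ p.toFinset : Finset (Fin d)) = ⊤ := by
    ext x; simp [hmem x]
  rwa [hu] at h

lemma IsSatChain.exists_eq_insertChain_empty {l : List (Finset (Fin d))}
    (h : IsSatChain (⊥ : Finset (Fin d)) ⊤ l) :
    ∃ p : List (Fin d), p.Nodup ∧ (∀ x, x ∈ p) ∧ l = insertChain ∅ p := by
  obtain ⟨p, hp, -, hl, ht⟩ := h.exists_eq_insertChain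
  refine ⟨p, hp, fun x => ?_, hl⟩
  have : x ∈ (⊤ : Finset (Fin d)) := Finset.mem_univ x
  rw [ht] at this
  simpa using this

lemma isSatChain_insertChain_pair {A : Finset (Fin d)} {a b : Fin d} (ha : a ∉ A) (hb : b ∉ A)
    (hab : a ≠ b) : IsSatChain A (A ∪ {a, b}) (insertChain A [a, b]) := by
  have h := isSatChain_insertChain A [a, b] (by simpa using hab) (by simp [ha, hb])
  rwa [List.toFinset_cons, List.toFinset_cons, List.toFinset_nil] at h

lemma eq_insertChain_pair {A : Finset (Fin d)} {a b : Fin d} (ha : a ∉ A) (hb : b ∉ A)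
    (hab : a ≠ b) {l : List (Finset (Fin d))} (hl : IsSatChain A (A ∪ {a, b}) l) :
    l = insertChain A [a, b] ∨ l = insertChain A [b, a] := by
  obtain ⟨p, hp, hpA, rfl, hB⟩ := hl.exists_eq_insertChain
  have hpm : p.Perm [a, b] := by
    refine (List.perm_ext_iff_of_nodup hp (by simpa using hab)).2 fun z => ?_
    have hz := Finset.ext_iff.1 hB z
    have hzA := hpA z
    simp only [Finset.mem_union, Finset.mem_insert, Finset.mem_singleton,
      List.mem_toFinset] at hz
    simp only [List.mem_cons, List.not_mem_nil, or_false]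
    refine ⟨fun h => (hz.2 (Or.inr h)).resolve_left (hzA h), fun h => ?_⟩
    refine (hz.1 (Or.inr h)).resolve_left ?_
    rcases h with rfl | rfl <;> assumption
  obtain ⟨x, y, rfl⟩ := List.length_eq_two.1 hpm.length_eq
  have hx := hpm.mem_iff (a := x)
  have hy := hpm.mem_iff (a := y)
  simp only [List.mem_cons, List.not_mem_nil, or_false, true_or, or_true, true_iff] at hx hy
  simp only [List.nodup_cons, List.mem_singleton] at hp
  rcases hx with rfl | rfl <;> rcases hy with rfl | rfl <;> simp_all

lemma IsELLabeling.chainWord_pair_ne (hEL : IsELLabeling lab) {A : Finset (Fin d)}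
    {a b : Fin d} (ha : a ∉ A) (hb : b ∉ A) (hab : a ≠ b) :
    chainWord lab (insertChain A [a, b]) ≠ chainWord lab (insertChain A [b, a]) := by
  intro heq
  have s1 := isSatChain_insertChain_pair ha hb hab
  have s2 := isSatChain_insertChain_pair hb ha hab.symm
  rw [Finset.pair_comm] at s2
  have hchne : insertChain A [a, b] ≠ insertChain A [b, a] := by
    intro h
    simp only [insertChain, List.cons.injEq, true_and] at h
    have h' : a ∈ insert b A := h.1 ▸ Finset.mem_insert_self a A
    exact (Finset.mem_insert.1 h').elim hab ha
  obtain ⟨⟨l, ⟨hl, hinc⟩, -⟩, hlex⟩ := hEL A (A ∪ {a, b}) Finset.subset_union_left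
  rcases eq_insertChain_pair ha hb hab hl with rfl | rfl
  · have h := hlex _ _ hl hinc s2 hchne.symm
    rw [heq] at h
    exact lex_lt_asymm h h
  · have h := hlex _ _ hl hinc s1 hchne
    rw [heq] at h
    exact lex_lt_asymm h h

lemma IsSdELLabeling.perm_of_pair (hEL : IsSdELLabeling d lab) {A : Finset (Fin d)}
    {a b : Fin d} (ha : a ∉ A) (hb : b ∉ A) (hab : a ≠ b) :
    (chainWord lab (insertChain ∅ A.toList) ++ (chainWord lab (insertChain A [a, b]) ++
      chainWord lab (insertChain (A ∪ {a, b}) (A ∪ {a, b})ᶜ.toList))).Perm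
        ((List.range d).map fun i => (i : ℤ) + 1) := by
  have hRm : ∀ x, x ∈ (A ∪ {a, b})ᶜ.toList ↔ x ∉ A ∧ x ≠ a ∧ x ≠ b := by
    intro x
    simp only [Finset.mem_toList, Finset.mem_compl, Finset.mem_union, Finset.mem_insert,
      Finset.mem_singleton, not_or, ne_eq]
  have hRn : (A ∪ {a, b})ᶜ.toList.Nodup := Finset.nodup_toList _
  generalize (A ∪ {a, b})ᶜ.toList = R at hRm hRn ⊢
  have hp : (A.toList ++ ([a, b] ++ R)).Nodup := by
    simp only [List.nodup_append, List.nodup_cons, List.mem_cons, List.mem_append,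
      Finset.mem_toList, hRm]
    refine ⟨A.nodup_toList, ⟨by simpa using hab, hRn, ?_⟩, ?_⟩ <;> grind
  have h := hEL.2 _ (isSatChain_bot_top_insertChain hp (by
    intro z
    simp only [List.mem_cons, List.mem_append, Finset.mem_toList, hRm]
    tauto))
  rw [chainWord_insertChain_append, chainWord_insertChain_append] at h
  have e1 : (∅ ∪ A.toList.toFinset : Finset (Fin d)) = A := by simp
  have e2 : [a, b].toFinset = {a, b} := by
    rw [List.toFinset_cons, List.toFinset_cons, List.toFinset_nil]; rfl
  rwa [e1, e2] at h

lemma IsSdELLabeling.lab_insert_insert (hEL : IsSdELLabeling d lab) {A : Finset (Fin d)}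
    {a b : Fin d} (ha : a ∉ A) (hb : b ∉ A) (hab : a ≠ b) :
    lab (insert b A) (insert a (insert b A)) = lab A (insert a A) := by
  have hperm : (chainWord lab (insertChain A [a, b])).Perm
      (chainWord lab (insertChain A [b, a])) := by
    have h1 := hEL.perm_of_pair ha hb hab
    have h2 := hEL.perm_of_pair hb ha hab.symm
    rw [Finset.pair_comm b a] at h2
    exact (List.perm_append_right_iff _).1 ((List.perm_append_left_iff _).1 (h1.trans h2.symm))
  have hne := hEL.1.chainWord_pair_ne ha hb hab
  simp only [insertChain, chainWord, List.tail_cons, List.zip_cons_cons, List.zip_nil_right,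
    List.map_cons, List.map_nil] at hperm hne
  have h1 := hperm.mem_iff (a := lab A (insert a A))
  have h2 := hperm.sum_eq
  simp only [List.mem_cons, List.not_mem_nil, or_false, true_or, true_iff, List.sum_cons,
    List.sum_nil, add_zero] at h1 h2
  rcases h1 with h1 | h1
  · refine absurd ?_ hne
    rw [h1] at h2 ⊢
    rw [add_left_cancel h2]
  · exact h1.symm

lemma IsSdELLabeling.lab_insert (hEL : IsSdELLabeling d lab) (A : Finset (Fin d)) :
    ∀ a ∉ A, lab A (insert a A) = lab ∅ {a} := by
  induction A using Finset.induction_on with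
  | empty => intro a _; rfl
  | insert b A hb ih =>
    intro a ha
    rw [Finset.mem_insert, not_or] at ha
    rw [hEL.lab_insert_insert ha.2 hb ha.1, ih a ha.2]

lemma IsSdELLabeling.chainWord_eq_map (hEL : IsSdELLabeling d lab) {p : List (Fin d)}
    (hp : p.Nodup) : chainWord lab (insertChain ∅ p) = p.map fun a => lab ∅ {a} :=
  chainWord_insertChain_eq_map lab _ hEL.lab_insert ∅ p hp (by simp)

lemma IsSdELLabeling.injective_lab_singleton (hEL : IsSdELLabeling d lab) :
    Function.Injective fun a => lab ∅ {a} := by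
  have hp : (Finset.univ : Finset (Fin d)).toList.Nodup := Finset.nodup_toList _
  have h := hEL.2 _ (isSatChain_bot_top_insertChain hp (by simp))
  rw [hEL.chainWord_eq_map hp] at h
  have hnd : ((List.range d).map fun i => (i : ℤ) + 1).Nodup := by
    change (List.map _ (List.flatMap (pure ∘ Nat.cast) (List.range d))).Nodup
    rw [List.flatMap_pure_eq_map, List.map_map]
    exact List.nodup_range.map fun i j hij => by simpa using hij
  have := List.inj_on_of_nodup_map (h.nodup_iff.2 hnd)
  exact fun a b hab => this (by simp) (by simp) hab

end Labeling

/-- Exchanging two consecutive values preserves all comparisons but the one between them. -/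
lemma lt_swap_iff {α : Type*} [DecidableEq α] {σ : α → ℤ} (hσ : Function.Injective σ) {a b : α}
    (hab : σ b < σ a) (hbetween : ∀ x, σ b < σ x → σ a ≤ σ x) {x y : α}
    (h1 : ¬ (x = a ∧ y = b)) (h2 : ¬ (x = b ∧ y = a)) :
    σ (Equiv.swap a b x) < σ (Equiv.swap a b y) ↔ σ x < σ y := by
  have hx := hbetween x
  have hy := hbetween y
  have e1 : σ x = σ a → x = a := fun h => hσ h
  have e2 : σ x = σ b → x = b := fun h => hσ h
  have e3 : σ y = σ a → y = a := fun h => hσ h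
  have e4 : σ y = σ b → y = b := fun h => hσ h
  simp only [Equiv.swap_apply_def]
  grind

lemma wordDescents_map_swap {α : Type*} [DecidableEq α] {σ : α → ℤ} (hσ : Function.Injective σ)
    {a b : α} (hab : σ b < σ a) (hbetween : ∀ x, σ b < σ x → σ a ≤ σ x) {p : List α}
    (hp : p.Nodup) {k : ℕ} (ha : a ∈ p.take k) (hb : b ∈ p.drop k)
    (hk : k ∉ wordDescents (p.map σ)) :
    wordDescents ((p.map (Equiv.swap a b)).map σ) = wordDescents (p.map σ) := by
  obtain ⟨i, hi, rfl⟩ := List.mem_take_iff_getElem.1 ha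
  obtain ⟨j, hj, rfl⟩ := List.mem_drop_iff_getElem.1 hb
  have hinj : ∀ (m n : ℕ) (hm : m < p.length) (hn : n < p.length), p[m] = p[n] → m = n :=
    fun m n hm hn h => (hp.getElem_inj_iff).1 h
  unfold wordDescents at hk ⊢
  simp only [List.length_map] at hk ⊢
  refine Finset.filter_congr fun n hn => ?_
  rw [Finset.mem_Icc] at hn
  have hn1 : n < p.length := by omega
  have hn2 : n - 1 < p.length := by omega
  rw [List.getD_eq_getElem _ _ (by simpa), List.getD_eq_getElem _ _ (by simpa),
    List.getD_eq_getElem _ _ (by simpa), List.getD_eq_getElem _ _ (by simpa)]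
  simp only [List.getElem_map]
  apply lt_swap_iff hσ hab hbetween
  · rintro ⟨h1, h2⟩
    have := hinj _ _ _ _ h1
    have := hinj _ _ _ _ h2
    omega
  · rintro ⟨h1, h2⟩
    have e1 := hinj _ _ _ _ h1
    have e2 := hinj _ _ _ _ h2
    obtain rfl : n = k := by omega
    apply hk
    rw [Finset.mem_filter, Finset.mem_Icc, List.getD_eq_getElem _ _ (by simpa),
      List.getD_eq_getElem _ _ (by simpa)]
    refine ⟨hn, ?_⟩
    simp only [List.getElem_map]
    rwa [h1, h2]

lemma map_swap_lex {α : Type*} [DecidableEq α] {σ : α → ℤ} {a b : α} (hab : σ b < σ a)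
    {p : List α} (hp : p.Nodup) {k : ℕ} (ha : a ∈ p.take k) (hb : b ∈ p.drop k) :
    List.Lex (· < ·) ((p.map (Equiv.swap a b)).map σ) (p.map σ) := by
  obtain ⟨s, t, hst⟩ := List.append_of_mem ha
  have hpe : p = s ++ a :: (t ++ p.drop k) := by
    conv_lhs => rw [← List.take_append_drop k p, hst]
    simp
  have hnd : (s ++ a :: (t ++ p.drop k)).Nodup := hpe ▸ hp
  have hs : s.map (Equiv.swap a b) = s := by
    conv_rhs => rw [← List.map_id s]
    refine List.map_congr_left fun x hx => Equiv.swap_apply_of_ne_of_ne ?_ ?_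
    · rintro rfl
      exact (List.nodup_append.1 hnd).2.2 x hx x (by simp) rfl
    · rintro rfl
      exact (List.nodup_append.1 hnd).2.2 x hx x (by simp [hb]) rfl
  rw [hpe]
  simp only [List.map_append, List.map_cons, hs, Equiv.swap_apply_left]
  exact List.Lex.append_left _ (List.Lex.rel hab) _

lemma lt_of_mem_take_of_mem_drop {α : Type*} [DecidableEq α] {σ : α → ℤ}
    (hσ : Function.Injective σ) {p : List α} (hp : p.Nodup) (hmem : ∀ x, x ∈ p)
    (hmin : ∀ q : List α, q.Nodup → (∀ x, x ∈ q) →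
      wordDescents (q.map σ) = wordDescents (p.map σ) →
      ¬ List.Lex (· < ·) (q.map σ) (p.map σ))
    {k : ℕ} (hk : k ∉ wordDescents (p.map σ)) {a b : α}
    (ha : a ∈ p.take k) (hb : b ∈ p.drop k) : σ a < σ b := by
  by_contra hlt
  induction hn : (σ a - σ b).toNat using Nat.strong_induction_on generalizing a b with
  | _ n ih =>
  have hne : a ≠ b := by
    rintro rfl
    exact List.disjoint_take_drop hp le_rfl ha hb
  have hab : σ b < σ a := lt_of_le_of_ne (not_lt.1 hlt) fun h => hne (hσ h).symm
  have hbetween : ∀ x, σ b < σ x → σ a ≤ σ x := by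
    intro x hx
    by_contra hxa
    have hxp := hmem x
    rw [← List.take_append_drop k p, List.mem_append] at hxp
    rcases hxp with h | h
    · exact ih _ (by omega) h hb (by omega) rfl
    · exact ih _ (by omega) ha h (by omega) rfl
  refine hmin (p.map (Equiv.swap a b)) (hp.map (Equiv.injective _)) (fun x => ?_)
    (wordDescents_map_swap hσ hab hbetween hp ha hb hk) (map_swap_lex hab hp ha hb)
  exact List.mem_map.2 ⟨Equiv.swap a b x, hmem _, by simp⟩

/-- fix an `S_d`-EL-labeling `λ` of `B_d` and `S ⊆ [d−1]`, with
`d_1, …, d_t` (the entries of `D`) all maximal chains of `B_d` whose `λ`-labels have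
descent set `S`, in lexicographic order of their labels.  If `c` is the unique maximal
chain of `B_d` with strictly increasing `λ`-label, then `Υ_λ((d_1)_{[d−1]∖S}) = c`. -/
theorem upsilon_of_first_chain (d : ℕ) (lab : Finset (Fin d) → Finset (Fin d) → ℤ)
    (hEL : IsSdELLabeling d lab) (S : Finset ℕ) (hS : S ⊆ Finset.Icc 1 (d - 1))
    (D : List (List (Finset (Fin d))))
    (hD : ∀ l : List (Finset (Fin d)), l ∈ D ↔
      IsSatChain (⊥ : Finset (Fin d)) (⊤ : Finset (Fin d)) l ∧
        wordDescents (chainWord lab l) = S)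
    (hDnd : D.Nodup)
    (hDlex : D.Pairwise fun l l' => List.Lex (· < ·) (chainWord lab l) (chainWord lab l'))
    (hne : D ≠ [])
    (c : List (Finset (Fin d)))
    (hc : IsSatChain (⊥ : Finset (Fin d)) (⊤ : Finset (Fin d)) c)
    (hcinc : (chainWord lab c).Chain' (· < ·))
    (u : List (Finset (Fin d)))
    (hu : IsUpsilon d lab (rsel d (Finset.Icc 1 (d - 1) \ S) (D.getD 0 [])) u) :
    u = c := by
  have hσ := hEL.injective_lab_singleton
  obtain ⟨d₁, D', rfl⟩ := List.exists_cons_of_ne_nil hne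
  rw [List.getD_cons_zero] at hu
  obtain ⟨hd₁, hdes⟩ := (hD d₁).1 (by simp)
  obtain ⟨p, hp, hpm, rfl⟩ := hd₁.exists_eq_insertChain_empty
  obtain ⟨husat, -, hudes⟩ := hu
  obtain ⟨r, hr, hrm, rfl⟩ := husat.exists_eq_insertChain_empty
  have hsep : ∀ k ∉ S, ∀ a ∈ p.take k, ∀ b ∈ p.drop k, lab ∅ {a} < lab ∅ {b} := by
    intro k hk a ha b hb
    refine lt_of_mem_take_of_mem_drop hσ hp hpm (fun q hq hqm hqdes hlex => ?_) (k := k) ?_ ha hb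
    · rw [← hEL.chainWord_eq_map hq, ← hEL.chainWord_eq_map hp] at hqdes hlex
      rcases List.mem_cons.1 ((hD _).2 ⟨isSatChain_bot_top_insertChain hq hqm,
        hqdes.trans hdes⟩) with h | h
      · rw [h] at hlex
        exact lex_lt_asymm hlex hlex
      · exact lex_lt_asymm hlex ((List.pairwise_cons.1 hDlex).1 _ h)
    · rwa [← hEL.chainWord_eq_map hp, hdes]
  have hlen : ∀ q : List (Fin d), q.Nodup → (∀ x, x ∈ q) → q.length = d := by
    intro q hq hqm
    rw [← List.toFinset_card_of_nodup hq, Finset.eq_univ_of_forall (s := q.toFinset) (by simpa using hqm)]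
    simp
  have hpl := hlen p hp hpm
  have hrl := hlen r hr hrm
  refine (hEL.1 ⊥ ⊤ bot_le).1.unique ⟨husat, ?_⟩ ⟨hc, hcinc⟩
  rw [hEL.chainWord_eq_map hr] at hudes ⊢
  refine List.isChain_iff_getElem.2 fun k hk => ?_
  simp only [List.length_map] at hk hudes
  have hd := hudes k hk
  rw [List.getD_eq_getElem _ _ (by simpa), List.getD_eq_getElem _ _ (by simp; omega)] at hd
  by_contra hlt
  simp only [List.getElem_map] at hlt hd
  have hne : lab ∅ {r[k + 1]} ≠ lab ∅ {r[k]} := by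
    intro h
    have := (hr.getElem_inj_iff).1 (hσ h)
    omega
  specialize hd (lt_of_le_of_ne (not_lt.1 hlt) hne)
  rw [List.getD_eq_getElem?_getD, getElem?_insertChain _ _ _ (by omega), Option.getD_some,
    rsel, List.mem_filter, decide_eq_true_iff] at hd
  obtain ⟨hX, hcard⟩ := hd
  have hcr : (∅ ∪ (r.take (k + 1)).toFinset).card = k + 1 := by
    rw [Finset.empty_union, List.toFinset_card_of_nodup (hr.sublist (List.take_sublist _ _)),
      List.length_take]
    omega
  obtain ⟨j, hj, hjX⟩ := exists_take_of_mem_insertChain hX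
  have hjk : j = k + 1 := by
    rw [hjX, Finset.empty_union,
      List.toFinset_card_of_nodup (hp.sublist (List.take_sublist _ _)), List.length_take] at hcr
    omega
  subst hjk
  rw [hcr] at hcard
  simp only [Finset.mem_union, Finset.mem_sdiff, Finset.mem_insert, Finset.mem_singleton] at hcard
  have hkS : k + 1 ∉ S := by
    rcases hcard with h | h
    · exact h.2
    · omega
  simp only [Finset.empty_union, Finset.ext_iff, List.mem_toFinset] at hjX
  refine hlt (hsep (k + 1) hkS _ ((hjX _).1 ?_) _ ?_)
  · exact List.mem_take_iff_getElem.2 ⟨k, by omega, rfl⟩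
  · have h := hpm r[k + 1]
    rw [← List.take_append_drop (k + 1) p, List.mem_append] at h
    refine h.resolve_left fun h => ?_
    refine List.disjoint_take_drop hr le_rfl ((hjX _).2 h) ?_
    exact List.mem_drop_iff_getElem.2 ⟨0, by omega, by simp⟩
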